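/- arXiv:2203.13850 — 5 statements merged into one kernel-verified Lean document; each statement's English description precedes it below -/
import Mathlib

section
/- For all real numbers t > 0, s ≥ 0 and r ≥ t, one has s·r − 2·(r · log(r/t + √(r²/t² − 1)) − √(r² − t²)) ≤ 2·t·sinh(s/2). -/
theorem Real.convexOn_sinh_Ici : ConvexOn ℝ (Set.Ici 0) Real.sinh := by
  refine convexOn_of_deriv2_nonneg (convex_Ici 0) Real.continuous_sinh.continuousOn
    Real.differentiable_sinh.differentiableOn ?_ fun x hx => ?_
  · simpa using Real.differentiable_cosh.differentiableOn
  · simp only [interior_Ici, Set.mem_Ioi] at hx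
    simpa using hx.le

theorem Real.cosh_mul_sub_le_sinh_sub {a v : ℝ} (ha : 0 ≤ a) (hv : 0 ≤ v) :
    Real.cosh a * (v - a) ≤ Real.sinh v - Real.sinh a := by
  rcases lt_trichotomy a v with h | rfl | h
  · have := Real.convexOn_sinh_Ici.le_slope_of_hasDerivAt ha hv h (Real.hasDerivAt_sinh a)
    rwa [slope_def_field, le_div_iff₀ (sub_pos.2 h)] at this
  · simp
  · have := Real.convexOn_sinh_Ici.slope_le_of_hasDerivAt hv ha h (Real.hasDerivAt_sinh a)
    rw [slope_def_field, div_le_iff₀ (sub_pos.2 h)] at this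
    linarith

/-- For `t > 0`, `s ≥ 0` and `r ≥ t`, one has
`s·r − 2·φ_max(r) ≤ 2·t·sinh(s/2)`, where
`φ_max(r) = r·log(r/t + √(r²/t² − 1)) − √(r² − t²)` is the maximum over `s ≥ 0` of
`s·r − t·sinh s`. -/
theorem sr_sub_two_phiMax_le (t s r : ℝ) (ht : 0 < t) (hs : 0 ≤ s) (hr : t ≤ r) :
    s * r - 2 * (r * Real.log (r / t + Real.sqrt (r ^ 2 / t ^ 2 - 1)) -
      Real.sqrt (r ^ 2 - t ^ 2)) ≤ 2 * t * Real.sinh (s / 2) := by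
  have hx : 1 ≤ r / t := (one_le_div ht).2 hr
  have hsqrt : Real.sqrt (r ^ 2 - t ^ 2) = t * Real.sinh (Real.arcosh (r / t)) := by
    rw [Real.sinh_arcosh hx, ← Real.sqrt_sq ht.le, ← Real.sqrt_mul (sq_nonneg t),
      Real.sqrt_sq ht.le]
    congr 1
    field_simp
  have hlog : Real.log (r / t + Real.sqrt (r ^ 2 / t ^ 2 - 1)) = Real.arcosh (r / t) := by
    rw [Real.arcosh, div_pow]
  have key := Real.cosh_mul_sub_le_sinh_sub (Real.arcosh_nonneg hx) (div_nonneg hs zero_le_two)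
  rw [Real.cosh_arcosh hx] at key
  have hmul := mul_le_mul_of_nonneg_left key ht.le
  rw [← mul_assoc, mul_div_cancel₀ r ht.ne'] at hmul
  rw [hlog, hsqrt]
  linarith
end

section
/- For all real numbers t > 0 and r ≥ t, the integral ∫₀^∞ exp(t·(2·sinh(s/2) − sinh(s))) ds is finite, and ∫₀^∞ exp(s·r − t·sinh(s)) ds ≤ exp(2·φ_max(r)) · ∫₀^∞ exp(t·(2·sinh(s/2) − sinh(s))) ds. -/
open MeasureTheory

/-- `φ_max(t, r) = r·log(r/t + √(r²/t² − 1)) − √(r² − t²)`, the maximal value over `s ≥ 0`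
of `s ↦ s·r − t·sinh s` when `r ≥ t > 0`. -/
noncomputable def phiMax (t r : ℝ) : ℝ :=
  r * Real.log (r / t + Real.sqrt (r ^ 2 / t ^ 2 - 1)) - Real.sqrt (r ^ 2 - t ^ 2)

/-- On `[0, ∞)` the graph of `sinh` lies above its tangent lines. -/
theorem sub_mul_cosh_le_sinh_sub_sinh {a u : ℝ} (ha : 0 ≤ a) (hu : 0 ≤ u) :
    (u - a) * Real.cosh a ≤ Real.sinh u - Real.sinh a := by
  rcases lt_trichotomy a u with h | rfl | h
  · obtain ⟨c, hc, he⟩ := exists_hasDerivAt_eq_slope Real.sinh Real.cosh h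
      Real.continuous_sinh.continuousOn fun x _ => Real.hasDerivAt_sinh x
    rw [eq_div_iff (sub_pos.2 h).ne'] at he
    have hcosh : Real.cosh a ≤ Real.cosh c := by
      rw [Real.cosh_le_cosh, abs_of_nonneg ha, abs_of_nonneg (ha.trans hc.1.le)]
      exact hc.1.le
    nlinarith
  · simp
  · obtain ⟨c, hc, he⟩ := exists_hasDerivAt_eq_slope Real.sinh Real.cosh h
      Real.continuous_sinh.continuousOn fun x _ => Real.hasDerivAt_sinh x
    rw [eq_div_iff (sub_pos.2 h).ne'] at he
    have hcosh : Real.cosh c ≤ Real.cosh a := by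
      rw [Real.cosh_le_cosh, abs_of_nonneg ha, abs_of_nonneg (hu.trans hc.1.le)]
      exact hc.2.le
    nlinarith

theorem phiMax_eq_arcosh {t r : ℝ} (ht : 0 < t) (hr : t ≤ r) :
    phiMax t r = r * Real.arcosh (r / t) - t * Real.sinh (Real.arcosh (r / t)) := by
  have hsqrt : Real.sqrt (r ^ 2 - t ^ 2) = t * Real.sqrt ((r / t) ^ 2 - 1) := by
    rw [← Real.sqrt_sq ht.le, ← Real.sqrt_mul (sq_nonneg t), Real.sqrt_sq ht.le]
    congr 1
    field_simp
  rw [Real.sinh_arcosh ((one_le_div ht).2 hr), ← hsqrt, phiMax, Real.arcosh, div_pow]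

theorem mul_sub_mul_sinh_le_phiMax {t r u : ℝ} (ht : 0 < t) (hr : t ≤ r) (hu : 0 ≤ u) :
    u * r - t * Real.sinh u ≤ phiMax t r := by
  have hrt : 1 ≤ r / t := (one_le_div ht).2 hr
  have h := sub_mul_cosh_le_sinh_sub_sinh (Real.arcosh_nonneg hrt) hu
  rw [Real.cosh_arcosh hrt] at h
  have h' := mul_le_mul_of_nonneg_left h ht.le
  have he : t * ((u - Real.arcosh (r / t)) * (r / t)) = (u - Real.arcosh (r / t)) * r := by
    field_simp
  rw [phiMax_eq_arcosh ht hr]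
  linarith

theorem two_mul_sinh_half_sub_sinh_le {s : ℝ} (hs : 0 ≤ s) :
    2 * Real.sinh (s / 2) - Real.sinh s ≤ 1 - s / 2 := by
  obtain ⟨x, rfl⟩ : ∃ x, s = 2 * (2 * x) := ⟨s / 4, by ring⟩
  have hx : 0 ≤ x := by linarith
  have h1 : x ≤ Real.sinh x := Real.self_le_sinh_iff.2 hx
  have h2 : 2 * x ≤ Real.sinh (2 * x) := Real.self_le_sinh_iff.2 (by linarith)
  have hcosh : Real.cosh (2 * x) - 1 = 2 * Real.sinh x ^ 2 := by
    rw [Real.cosh_two_mul, Real.cosh_sq]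
    ring
  have hsq : 2 * x ^ 2 ≤ Real.cosh (2 * x) - 1 := by
    rw [hcosh]
    gcongr
  have hmul : 2 * x * (2 * x ^ 2) ≤ Real.sinh (2 * x) * (Real.cosh (2 * x) - 1) := by
    gcongr
  rw [mul_div_cancel_left₀ _ (two_ne_zero' ℝ), Real.sinh_two_mul (2 * x)]
  nlinarith [mul_nonneg hx (sq_nonneg (2 * x - 1)), sq_nonneg (2 * x - 1)]

/-- For `t > 0` and `r ≥ t`, the integral `∫₀^∞ exp(t(2 sinh(s/2) − sinh s)) ds` is finite and
`∫₀^∞ exp(s·r − t·sinh s) ds ≤ exp(2 φ_max(t,r)) · ∫₀^∞ exp(t(2 sinh(s/2) − sinh s)) ds`. -/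
theorem laplace_integral_phiMax_bound (t r : ℝ) (ht : 0 < t) (hr : t ≤ r) :
    (∫⁻ s in Set.Ioi (0 : ℝ),
        ENNReal.ofReal (Real.exp (t * (2 * Real.sinh (s / 2) - Real.sinh s)))) < ⊤ ∧
    (∫⁻ s in Set.Ioi (0 : ℝ), ENNReal.ofReal (Real.exp (s * r - t * Real.sinh s)))
      ≤ ENNReal.ofReal (Real.exp (2 * phiMax t r)) *
        ∫⁻ s in Set.Ioi (0 : ℝ),
          ENNReal.ofReal (Real.exp (t * (2 * Real.sinh (s / 2) - Real.sinh s))) := by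
  constructor
  · have hint : IntegrableOn (fun s : ℝ => Real.exp t * Real.exp (-(t / 2) * s))
        (Set.Ioi 0) :=
      (exp_neg_integrableOn_Ioi 0 (half_pos ht)).const_mul _
    refine lt_of_le_of_lt (setLIntegral_mono' measurableSet_Ioi fun s hs => ?_)
      hint.lintegral_lt_top
    rw [← Real.exp_add]
    refine ENNReal.ofReal_le_ofReal (Real.exp_le_exp.2 ?_)
    have h := mul_le_mul_of_nonneg_left
      (two_mul_sinh_half_sub_sinh_le (Set.mem_Ioi.1 hs).le) ht.le
    linarith
  · rw [← lintegral_const_mul' _ _ ENNReal.ofReal_ne_top]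
    refine setLIntegral_mono' measurableSet_Ioi fun s hs => ?_
    rw [← ENNReal.ofReal_mul (Real.exp_pos _).le, ← Real.exp_add]
    refine ENNReal.ofReal_le_ofReal (Real.exp_le_exp.2 ?_)
    have h := mul_sub_mul_sinh_le_phiMax ht hr (half_pos (Set.mem_Ioi.1 hs)).le
    linarith
end

section
/- Let λ > 0 and z ∈ ℂ. The function v : ℝ → ℂ defined by v(x) = J_z(√λ · e^{−x}) is twice differentiable and satisfies the Schrödinger equation v''(x) = (z² − λ·e^{−2x}) · v(x) for all x ∈ ℝ. -/
/-- The Bessel function `J_z(t)` of complex order `z` evaluated at `t > 0`. -/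
noncomputable def besselJ (z : ℂ) (t : ℝ) : ℂ :=
  ∑' m : ℕ, (-1 : ℂ) ^ m * Complex.exp ((z + 2 * (m : ℂ)) * (Real.log (t / 2) : ℂ)) /
    ((Nat.factorial m : ℂ) * Complex.Gamma (z + (m : ℂ) + 1))

/-- The coefficient `(-1)^m / (m! Γ(z+m+1))` of the Bessel series. -/
noncomputable def besselCoeff (z : ℂ) (m : ℕ) : ℂ :=
  (-1 : ℂ) ^ m / ((Nat.factorial m : ℂ) * Complex.Gamma (z + (m : ℂ) + 1))

/-- The Bessel coefficients satisfy a two-term recurrence, also where `Γ` has poles. -/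
theorem besselCoeff_succ (z : ℂ) (m : ℕ) :
    ((m : ℂ) + 1) * (z + m + 1) * besselCoeff z (m + 1) = -besselCoeff z m := by
  have h := Complex.one_div_Gamma_eq_self_mul_one_div_Gamma_add_one (z + m + 1)
  have hm : (m : ℂ) + 1 ≠ 0 := Nat.cast_add_one_ne_zero m
  have hf : (Nat.factorial m : ℂ) ≠ 0 := Nat.cast_ne_zero.2 (Nat.factorial_ne_zero m)
  have e : z + ((m + 1 : ℕ) : ℂ) + 1 = z + m + 1 + 1 := by push_cast; ring
  rw [besselCoeff, besselCoeff, e]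
  simp only [div_eq_mul_inv, mul_inv, h, Nat.factorial_succ, Nat.cast_mul,
    Nat.cast_add, Nat.cast_one, pow_succ]
  field_simp

theorem summable_norm_besselCoeff_mul_pow (z : ℂ) {r : ℝ} (hr : 0 ≤ r) :
    Summable fun m : ℕ => ‖besselCoeff z m‖ * r ^ m := by
  refine summable_of_ratio_norm_eventually_le (r := 1 / 2) (by norm_num) ?_
  obtain ⟨N, hN⟩ := exists_nat_ge (‖z‖ + 2 * r)
  filter_upwards [Filter.eventually_ge_atTop N] with m hm
  have hm' : ‖z‖ + 2 * r ≤ m := hN.trans (by exact_mod_cast hm)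
  have h1 : ‖(m : ℂ) + 1‖ = m + 1 := by
    exact_mod_cast Complex.norm_natCast (m + 1)
  have h2 : 2 * r ≤ ‖z + m + 1‖ := by
    have := norm_sub_le (z + m + 1) z
    rw [show z + m + 1 - z = (m : ℂ) + 1 by ring, h1] at this
    linarith
  have h3 := congrArg norm (besselCoeff_succ z m)
  rw [norm_neg, norm_mul, norm_mul, h1] at h3
  have h4 : 2 * r * ‖besselCoeff z (m + 1)‖ ≤ ‖besselCoeff z m‖ := by
    rw [← h3]
    refine mul_le_mul_of_nonneg_right ?_ (norm_nonneg _)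
    nlinarith [norm_nonneg (z + m + 1), (Nat.cast_nonneg m : (0 : ℝ) ≤ m)]
  rw [Real.norm_of_nonneg (by positivity), Real.norm_of_nonneg (by positivity), pow_succ]
  nlinarith [mul_le_mul_of_nonneg_right h4 (pow_nonneg hr m)]

theorem summable_norm_add_two_mul_mul_pow (z : ℂ) {c : ℕ → ℂ}
    (hc : ∀ r : ℝ, 0 ≤ r → Summable fun m : ℕ => ‖c m‖ * r ^ m) {r : ℝ} (hr : 0 ≤ r) :
    Summable fun m : ℕ => ‖(z + 2 * m) * c m‖ * r ^ m := by
  refine Summable.of_nonneg_of_le (fun m => by positivity) (fun m => ?_)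
    ((hc (2 * r) (by positivity)).mul_left (‖z‖ + 2))
  have h1 : ‖z + 2 * (m : ℂ)‖ ≤ ‖z‖ + 2 * m := (norm_add_le _ _).trans (by simp)
  have h2 : (m : ℝ) ≤ 2 ^ m := by exact_mod_cast Nat.lt_two_pow_self.le
  have h3 : (1 : ℝ) ≤ 2 ^ m := one_le_pow₀ (by norm_num)
  have h4 : ‖z + 2 * (m : ℂ)‖ ≤ (‖z‖ + 2) * 2 ^ m := by
    nlinarith [norm_nonneg z]
  rw [norm_mul, mul_pow]
  calc ‖z + 2 * (m : ℂ)‖ * ‖c m‖ * r ^ m ≤ (‖z‖ + 2) * 2 ^ m * ‖c m‖ * r ^ m := by gcongr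
    _ = _ := by ring

theorem norm_exp_add_two_mul_mul_le (z : ℂ) (m : ℕ) {y b : ℝ} (hy : |y| ≤ b) :
    ‖Complex.exp ((z + 2 * (m : ℂ)) * y)‖ ≤ Real.exp (‖z‖ * b) * Real.exp (2 * b) ^ m := by
  rw [Complex.norm_exp, ← Real.exp_nat_mul, ← Real.exp_add, Real.exp_le_exp]
  have e : ((z + 2 * (m : ℂ)) * (y : ℂ)).re = z.re * y + m * (2 * y) := by
    simp; ring
  rw [e]
  have h1 : z.re * y ≤ ‖z‖ * b := (le_abs_self _).trans <| by
    rw [abs_mul]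
    exact mul_le_mul (Complex.abs_re_le_norm z) hy (abs_nonneg y) (norm_nonneg z)
  have h2 : y ≤ b := (le_abs_self y).trans hy
  gcongr

theorem summable_mul_exp_add_two_mul (z : ℂ) {c : ℕ → ℂ}
    (hc : ∀ r : ℝ, 0 ≤ r → Summable fun m : ℕ => ‖c m‖ * r ^ m) (y : ℝ) :
    Summable fun m : ℕ => c m * Complex.exp ((z + 2 * (m : ℂ)) * y) := by
  refine Summable.of_norm_bounded ((hc (Real.exp (2 * |y|)) (Real.exp_pos _).le).mul_left
    (Real.exp (‖z‖ * |y|))) fun m => ?_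
  rw [norm_mul, mul_left_comm]
  exact mul_le_mul_of_nonneg_left (norm_exp_add_two_mul_mul_le z m le_rfl) (norm_nonneg _)

/-- A generalized exponential series with rapidly decaying coefficients may be differentiated
term by term. -/
theorem hasDerivAt_tsum_mul_exp_add_two_mul (z : ℂ) {c : ℕ → ℂ}
    (hc : ∀ r : ℝ, 0 ≤ r → Summable fun m : ℕ => ‖c m‖ * r ^ m) (y₀ : ℝ) :
    HasDerivAt (fun y : ℝ => ∑' m : ℕ, c m * Complex.exp ((z + 2 * (m : ℂ)) * y))
      (∑' m : ℕ, (z + 2 * m) * c m * Complex.exp ((z + 2 * (m : ℂ)) * y₀)) y₀ := by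
  set b := |y₀| + 1 with hb
  have hy₀ : y₀ ∈ Set.Ioo (-b) b := abs_lt.1 (by linarith)
  refine hasDerivAt_tsum_of_isPreconnected
    (g := fun (m : ℕ) (y : ℝ) => c m * Complex.exp ((z + 2 * (m : ℂ)) * y))
    (g' := fun (m : ℕ) (y : ℝ) => (z + 2 * m) * c m * Complex.exp ((z + 2 * (m : ℂ)) * y))
    ((summable_norm_add_two_mul_mul_pow z hc (Real.exp_pos (2 * b)).le).mul_left
      (Real.exp (‖z‖ * b))) isOpen_Ioo isPreconnected_Ioo (fun m y _ => ?_) (fun m y hy => ?_)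
    hy₀ (summable_mul_exp_add_two_mul z hc y₀) hy₀
  · have h := ((Complex.ofRealCLM.hasDerivAt (x := y)).const_mul (z + 2 * (m : ℂ))).cexp.const_mul
      (c m)
    refine h.congr_deriv ?_
    simp only [Complex.ofRealCLM_apply, Complex.ofReal_one]
    ring
  · rw [norm_mul, mul_left_comm]
    exact mul_le_mul_of_nonneg_left (norm_exp_add_two_mul_mul_le z m (abs_lt.2 hy).le)
      (norm_nonneg _)

theorem tsum_sq_mul_besselCoeff_mul_exp (z : ℂ) (y : ℝ) :
    ∑' m : ℕ, (z + 2 * m) * ((z + 2 * m) * besselCoeff z m) *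
        Complex.exp ((z + 2 * (m : ℂ)) * y) =
      (z ^ 2 - 4 * Complex.exp (2 * y)) *
        ∑' m : ℕ, besselCoeff z m * Complex.exp ((z + 2 * (m : ℂ)) * y) := by
  have hc : ∀ r : ℝ, 0 ≤ r → Summable fun m : ℕ => ‖besselCoeff z m‖ * r ^ m :=
    fun r hr => summable_norm_besselCoeff_mul_pow z hr
  have h0 := summable_mul_exp_add_two_mul z hc y
  have h2 := summable_mul_exp_add_two_mul z (fun r hr => summable_norm_add_two_mul_mul_pow z
    (fun r hr => summable_norm_add_two_mul_mul_pow z hc hr) hr) y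
  have hsub := (h2.sub (h0.mul_left (z ^ 2))).tsum_eq_zero_add
  rw [h2.tsum_sub (h0.mul_left (z ^ 2)), tsum_mul_left] at hsub
  have hterm : ∀ m : ℕ, (z + 2 * (m + 1 : ℕ)) * ((z + 2 * (m + 1 : ℕ)) * besselCoeff z (m + 1)) *
        Complex.exp ((z + 2 * ((m + 1 : ℕ) : ℂ)) * y) -
      z ^ 2 * (besselCoeff z (m + 1) * Complex.exp ((z + 2 * ((m + 1 : ℕ) : ℂ)) * y)) =
      -(4 * Complex.exp (2 * y)) * (besselCoeff z m * Complex.exp ((z + 2 * (m : ℂ)) * y)) := by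
    intro m
    have e : Complex.exp ((z + 2 * ((m + 1 : ℕ) : ℂ)) * y) =
        Complex.exp (2 * y) * Complex.exp ((z + 2 * (m : ℂ)) * y) := by
      rw [← Complex.exp_add]; congr 1; push_cast; ring
    rw [e]
    push_cast
    linear_combination (4 * Complex.exp (2 * y) * Complex.exp ((z + 2 * (m : ℂ)) * y)) *
      besselCoeff_succ z m
  simp only [hterm, tsum_mul_left] at hsub
  simp only [Nat.cast_zero, mul_zero, add_zero] at hsub
  linear_combination hsub

theorem besselJ_eq_tsum_besselCoeff (z : ℂ) (t : ℝ) :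
    besselJ z t =
      ∑' m : ℕ, besselCoeff z m * Complex.exp ((z + 2 * (m : ℂ)) * (Real.log (t / 2) : ℂ)) := by
  simp only [besselJ, besselCoeff, div_mul_eq_mul_div]

/-- For `λ > 0` and `z ∈ ℂ`, the function `v(x) = J_z(√λ e^{−x})` is twice differentiable on `ℝ`
and satisfies the Schrödinger equation `v'' = (z² − λ e^{−2x}) v`. -/
theorem besselJ_schrodinger_solution (lam : ℝ) (hlam : 0 < lam) (z : ℂ) :
    ∃ v' v'' : ℝ → ℂ,
      (∀ x : ℝ, HasDerivAt (fun x : ℝ => besselJ z (Real.sqrt lam * Real.exp (-x))) (v' x) x) ∧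
      (∀ x : ℝ, HasDerivAt v' (v'' x) x) ∧
      (∀ x : ℝ, v'' x = (z ^ 2 - (lam : ℂ) * Complex.exp (-2 * (x : ℂ))) *
        besselJ z (Real.sqrt lam * Real.exp (-x))) := by
  set L := Real.log (Real.sqrt lam / 2) with hL
  have hpos : 0 < Real.sqrt lam / 2 := by positivity
  have hlog : ∀ x : ℝ, Real.log (Real.sqrt lam * Real.exp (-x) / 2) = L - x := by
    intro x
    rw [mul_div_right_comm, Real.log_mul hpos.ne' (Real.exp_pos _).ne', Real.log_exp, hL,
      sub_eq_add_neg]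
  have hc : ∀ r : ℝ, 0 ≤ r → Summable fun m : ℕ => ‖besselCoeff z m‖ * r ^ m :=
    fun r hr => summable_norm_besselCoeff_mul_pow z hr
  have hc' : ∀ r : ℝ, 0 ≤ r → Summable fun m : ℕ => ‖(z + 2 * m) * besselCoeff z m‖ * r ^ m :=
    fun r hr => summable_norm_add_two_mul_mul_pow z hc hr
  have hexp : ∀ x : ℝ, 4 * Complex.exp (2 * ((L - x : ℝ) : ℂ)) =
      (lam : ℂ) * Complex.exp (-2 * (x : ℂ)) := by
    intro x
    have h : 4 * Real.exp (2 * (L - x)) = lam * Real.exp (-2 * x) := by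
      rw [show 2 * (L - x) = L + L + -2 * x by ring, Real.exp_add, Real.exp_add, hL,
        Real.exp_log hpos]
      linear_combination Real.exp (-2 * x) * Real.mul_self_sqrt hlam.le
    exact_mod_cast congrArg Complex.ofReal h
  have hv : (fun x : ℝ => besselJ z (Real.sqrt lam * Real.exp (-x))) = fun x : ℝ =>
      ∑' m : ℕ, besselCoeff z m * Complex.exp ((z + 2 * (m : ℂ)) * ((L - x : ℝ) : ℂ)) := by
    funext x
    rw [besselJ_eq_tsum_besselCoeff, hlog]
  refine ⟨fun x => -∑' m : ℕ, (z + 2 * m) * besselCoeff z m *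
      Complex.exp ((z + 2 * (m : ℂ)) * ((L - x : ℝ) : ℂ)),
    fun x => ∑' m : ℕ, (z + 2 * m) * ((z + 2 * m) * besselCoeff z m) *
      Complex.exp ((z + 2 * (m : ℂ)) * ((L - x : ℝ) : ℂ)), fun x => ?_, fun x => ?_, fun x => ?_⟩
  · rw [hv]
    exact (hasDerivAt_tsum_mul_exp_add_two_mul z hc (L - x)).comp_const_sub L x
  · simpa only [neg_neg] using
      ((hasDerivAt_tsum_mul_exp_add_two_mul z hc' (L - x)).comp_const_sub L x).fun_neg
  · rw [besselJ_eq_tsum_besselCoeff, hlog, ← hexp]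
    exact tsum_sq_mul_besselCoeff_mul_exp z (L - x)
end

section
/- Let λ > 0, a > 0, let Q : ℝ → ℝ be integrable with support in [0, a], set q₀(x) := −λ·e^{−2x} and q := q₀ + Q, and assume M := sup{ ∫₀^{(t−x)/2} |q(α−β) − q₀(α+β)| dβ : (t−x)/2 ≤ α ≤ a, 0 ≤ x ≤ t } is finite. Define, for bounded continuous L on Ω = {(x,t) : 0 ≤ x ≤ t}, the operator G(L)(x,t) := ∫_{(t+x)/2}^∞ ∫₀^{(t−x)/2} (q(α−β) − q₀(α+β)) · L(α−β, α+β) dβ dα. Then for every bounded continuous L on Ω vanishing when x + t ≥ 2a, every n ∈ ℕ and every (x,t) ∈ Ω, the n-th iterate satisfies |Gⁿ(L)(x,t)| ≤ (Mⁿ / n!) · (max(a − (t+x)/2, 0))ⁿ · ‖L‖_∞. In particular Gⁿ is a contraction in the supremum norm for n sufficiently large. -/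
open MeasureTheory

/-- The integral part of the Gelfand–Levitan fixed-point map:
`G(L)(x,t) = ∫_{(t+x)/2}^∞ ∫₀^{(t−x)/2} (q(α−β) − q₀(α+β)) L(α−β, α+β) dβ dα`. -/
noncomputable def GLop (q q₀ : ℝ → ℝ) (L : ℝ × ℝ → ℝ) : ℝ × ℝ → ℝ := fun w =>
  ∫ α in Set.Ioi ((w.2 + w.1) / 2), ∫ β in (0:ℝ)..((w.2 - w.1) / 2),
    (q (α - β) - q₀ (α + β)) * L (α - β, α + β)

/-- One step of the iteration: if the kernel has `β`-integrals bounded by `M` and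
`|L| ≤ B (a - (t + x) / 2) ^ n` on `Ω`, with `L = 0` on `x + t ≥ 2 a`, then `G(L)` gains one power
of `a - (t + x) / 2`, and the constant gains the factor `M / (n + 1)`. -/
theorem abs_GLop_le (q q₀ : ℝ → ℝ) (a M B : ℝ) (n : ℕ) (hB : 0 ≤ B)
    (hint : ∀ α c : ℝ, IntervalIntegrable (fun β => q (α - β) - q₀ (α + β)) volume 0 c)
    (hM : ∀ x t : ℝ, 0 ≤ x → x ≤ t → ∀ α ∈ Set.Icc ((t - x) / 2) a,
      (∫ β in (0:ℝ)..((t - x) / 2), |q (α - β) - q₀ (α + β)|) ≤ M)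
    (L : ℝ × ℝ → ℝ)
    (hL : ∀ x t : ℝ, 0 ≤ x → x ≤ t → |L (x, t)| ≤ B * (max (a - (t + x) / 2) 0) ^ n)
    (hL0 : ∀ x t : ℝ, 0 ≤ x → x ≤ t → 2 * a ≤ x + t → L (x, t) = 0)
    {x t : ℝ} (hx : 0 ≤ x) (hxt : x ≤ t) :
    |GLop q q₀ L (x, t)| ≤ B * M / (n + 1) * (max (a - (t + x) / 2) 0) ^ (n + 1) := by
  have hr : 0 ≤ (t - x) / 2 := by linarith
  have inner_zero : ∀ α : ℝ, (t + x) / 2 < α → a ≤ α →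
      ∫ β in (0:ℝ)..((t - x) / 2), (q (α - β) - q₀ (α + β)) * L (α - β, α + β) = 0 := by
    intro α hα haα
    apply intervalIntegral.integral_zero_ae
    refine Filter.Eventually.of_forall fun β hβ => ?_
    rw [Set.uIoc_of_le hr] at hβ
    rw [hL0 _ _ (by linarith [hβ.2]) (by linarith [hβ.1]) (by linarith), mul_zero]
  have inner_bound : ∀ α : ℝ, (t + x) / 2 < α → α ≤ a →
      ‖∫ β in (0:ℝ)..((t - x) / 2), (q (α - β) - q₀ (α + β)) * L (α - β, α + β)‖
        ≤ B * M * (a - α) ^ n := by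
    intro α hα haα
    have hD : 0 ≤ B * (a - α) ^ n := mul_nonneg hB (pow_nonneg (by linarith) n)
    calc ‖∫ β in (0:ℝ)..((t - x) / 2), (q (α - β) - q₀ (α + β)) * L (α - β, α + β)‖
        ≤ ∫ β in (0:ℝ)..((t - x) / 2), |q (α - β) - q₀ (α + β)| * (B * (a - α) ^ n) := by
          refine intervalIntegral.norm_integral_le_of_norm_le hr
            (Filter.Eventually.of_forall fun β hβ => ?_) ((hint α _).abs.mul_const _)
          rw [norm_mul, Real.norm_eq_abs, Real.norm_eq_abs]
          refine mul_le_mul_of_nonneg_left ?_ (abs_nonneg _)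
          have h := hL (α - β) (α + β) (by linarith [hβ.2]) (by linarith [hβ.1])
          rwa [show a - (α + β + (α - β)) / 2 = a - α by ring,
            max_eq_left (by linarith : (0:ℝ) ≤ a - α)] at h
      _ = (∫ β in (0:ℝ)..((t - x) / 2), |q (α - β) - q₀ (α + β)|) * (B * (a - α) ^ n) :=
          intervalIntegral.integral_mul_const _ _
      _ ≤ M * (B * (a - α) ^ n) :=
          mul_le_mul_of_nonneg_right (hM x t hx hxt α ⟨by linarith, haα⟩) hD
      _ = B * M * (a - α) ^ n := by ring
  dsimp only [GLop]
  rcases le_total a ((t + x) / 2) with h | h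
  · rw [setIntegral_eq_zero_of_forall_eq_zero fun α (hα : α ∈ Set.Ioi ((t + x) / 2)) =>
      inner_zero α hα (h.trans (Set.mem_Ioi.1 hα).le), max_eq_right (by linarith)]
    simp
  · rw [max_eq_left (by linarith), setIntegral_eq_of_subset_of_forall_sdiff_eq_zero
      measurableSet_Ioi (Set.Ioc_subset_Ioi_self : Set.Ioc ((t + x) / 2) a ⊆ _) fun α hα =>
        inner_zero α hα.1 (not_lt.1 fun h' => hα.2 ⟨hα.1, h'.le⟩),
      ← intervalIntegral.integral_of_le h, ← Real.norm_eq_abs]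
    calc _ ≤ ∫ α in ((t + x) / 2)..a, B * M * (a - α) ^ n :=
          intervalIntegral.norm_integral_le_of_norm_le h
            (Filter.Eventually.of_forall fun α hα => inner_bound α hα.1 hα.2)
            (Continuous.intervalIntegrable (by fun_prop) _ _)
      _ = B * M / (n + 1) * (a - (t + x) / 2) ^ (n + 1) := by
          rw [intervalIntegral.integral_const_mul,
            intervalIntegral.integral_comp_sub_left (fun y => y ^ n) a, integral_pow]
          simp
          ring

/-- With `q₀(x) = −λ e^{−2x}`, `q = q₀ + Q` for an integrable `Q` supported in `[0, a]`, and `M`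
a finite bound for `∫₀^{(t−x)/2} |q(α−β) − q₀(α+β)| dβ` over `(t−x)/2 ≤ α ≤ a`, `0 ≤ x ≤ t`:
for every bounded continuous `L` on `Ω = {0 ≤ x ≤ t}` vanishing when `x + t ≥ 2a`, every `n`
and every `(x,t) ∈ Ω`, the `n`-th iterate of `G` satisfies
`|Gⁿ(L)(x,t)| ≤ (Mⁿ/n!) (max(a − (t+x)/2, 0))ⁿ ‖L‖_∞`. -/
theorem GLop_iterate_bound (lam a : ℝ) (hlam : 0 < lam) (ha : 0 < a)
    (Q : ℝ → ℝ) (hQ : Integrable Q) (hQsupp : Function.support Q ⊆ Set.Icc 0 a)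
    (M : ℝ)
    (hM : ∀ x t : ℝ, 0 ≤ x → x ≤ t → ∀ α ∈ Set.Icc ((t - x) / 2) a,
      (∫ β in (0:ℝ)..((t - x) / 2),
        |(-lam * Real.exp (-2 * (α - β)) + Q (α - β)) - (-lam * Real.exp (-2 * (α + β)))|)
        ≤ M)
    (L : ℝ × ℝ → ℝ) (C : ℝ)
    (hL : ContinuousOn L {w : ℝ × ℝ | 0 ≤ w.1 ∧ w.1 ≤ w.2})
    (hLsupp : ∀ w : ℝ × ℝ, 0 ≤ w.1 → w.1 ≤ w.2 → 2 * a ≤ w.1 + w.2 → L w = 0)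
    (hLbd : ∀ w : ℝ × ℝ, 0 ≤ w.1 → w.1 ≤ w.2 → |L w| ≤ C) :
    ∀ n : ℕ, ∀ x t : ℝ, 0 ≤ x → x ≤ t →
      |((GLop (fun y => -lam * Real.exp (-2 * y) + Q y)
            (fun y => -lam * Real.exp (-2 * y)))^[n] L) (x, t)|
        ≤ M ^ n / (Nat.factorial n) * (max (a - (t + x) / 2) 0) ^ n * C := by
  have hint : ∀ α c : ℝ, IntervalIntegrable (fun β =>
      (-lam * Real.exp (-2 * (α - β)) + Q (α - β)) - (-lam * Real.exp (-2 * (α + β))))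
      volume 0 c := fun α c =>
    ((Continuous.intervalIntegrable (by fun_prop) _ _).add
      (hQ.comp_sub_left α).intervalIntegrable).sub
      (Continuous.intervalIntegrable (by fun_prop) _ _)
  have hM0 : 0 ≤ M := by simpa using hM 0 0 le_rfl le_rfl a ⟨by simpa using ha.le, le_rfl⟩
  have hC0 : 0 ≤ C := (abs_nonneg _).trans (hLbd (0, 0) le_rfl le_rfl)
  intro n
  induction n with
  | zero =>
    intro x t hx hxt
    simpa using hLbd (x, t) hx hxt
  | succ n ih =>
    intro x t hx hxt
    rw [Function.iterate_succ_apply']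
    refine (abs_GLop_le _ _ a M (M ^ n / (Nat.factorial n) * C) n (by positivity) hint hM _
      (fun x t hx hxt => (ih x t hx hxt).trans_eq (by ring)) (fun x t hx hxt h => ?_)
      hx hxt).trans_eq ?_
    · rcases n with _ | n
      · exact hLsupp (x, t) hx hxt h
      · have h' := ih x t hx hxt
        rw [max_eq_right (by linarith)] at h'
        simpa using h'
    · rw [Nat.factorial_succ]
      push_cast
      field_simp
      ring
end

section
/- Let λ > 0, a > 0, let Q : ℝ → ℝ be integrable with support in [0, a], set q₀(x) := −λ·e^{−2x} and q := q₀ + Q, and assume M := sup{ ∫₀^{(t−x)/2} |q(α−β) − q₀(α+β)| dβ : (t−x)/2 ≤ α ≤ a, 0 ≤ x ≤ t } is finite. Then there exists a unique continuous function K : Ω → ℝ with K(x,t) = 0 whenever x + t ≥ 2a, such that for all (x,t) with 0 ≤ x ≤ t: K(x,t) = (1/2)·∫_{(t+x)/2}^∞ Q(s) ds + ∫_{(t+x)/2}^∞ ∫₀^{(t−x)/2} (q(α−β) − q₀(α+β)) · K(α−β, α+β) dβ dα. -/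
open MeasureTheory

open Set Filter Topology
open scoped BoundedContinuousFunction

/-- Integrals of an integrable function over the quadrants `(u, ∞) × (0, v]` depend continuously
on the corner `(u, v)`. -/
theorem continuous_setIntegral_Ioi_prod_Ioc {W : ℝ × ℝ → ℝ} (hW : Integrable W) :
    Continuous fun p : ℝ × ℝ => ∫ x in Ioi p.1 ×ˢ Ioc 0 p.2, W x := by
  have hmeas : ∀ p : ℝ × ℝ, MeasurableSet (Ioi p.1 ×ˢ Ioc 0 p.2) := fun p =>
    measurableSet_Ioi.prod measurableSet_Ioc
  simp_rw [← integral_indicator (hmeas _)]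
  refine continuous_iff_continuousAt.2 fun p => ?_
  refine continuousAt_of_dominated (bound := fun x => ‖W x‖)
    (Eventually.of_forall fun q => (hW.indicator (hmeas q)).aestronglyMeasurable)
    (Eventually.of_forall fun q => Eventually.of_forall fun x => norm_indicator_le_norm_self _ _)
    hW.norm ?_
  have h1 : ∀ᵐ x : ℝ × ℝ, x.1 ≠ p.1 :=
    Measure.quasiMeasurePreserving_fst.ae (compl_mem_ae_iff.2 (measure_singleton p.1))
  have h2 : ∀ᵐ x : ℝ × ℝ, x.2 ≠ p.2 :=
    Measure.quasiMeasurePreserving_snd.ae (compl_mem_ae_iff.2 (measure_singleton p.2))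
  filter_upwards [h1, h2] with x hx1 hx2
  have e1 : ∀ᶠ q : ℝ × ℝ in 𝓝 p, (q.1 < x.1 ↔ p.1 < x.1) := by
    rcases lt_or_gt_of_ne hx1 with h | h
    · filter_upwards [continuous_fst.continuousAt.eventually (lt_mem_nhds h)] with q hq
      exact iff_of_false (not_lt.2 hq.le) (not_lt.2 h.le)
    · filter_upwards [continuous_fst.continuousAt.eventually (gt_mem_nhds h)] with q hq
      exact iff_of_true hq h
  have e2 : ∀ᶠ q : ℝ × ℝ in 𝓝 p, (x.2 ≤ q.2 ↔ x.2 ≤ p.2) := by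
    rcases lt_or_gt_of_ne hx2 with h | h
    · filter_upwards [continuous_snd.continuousAt.eventually (lt_mem_nhds h)] with q hq
      exact iff_of_true hq.le h.le
    · filter_upwards [continuous_snd.continuousAt.eventually (gt_mem_nhds h)] with q hq
      exact iff_of_false (not_le.2 hq) (not_le.2 h)
  refine continuousAt_const.congr (f := fun _ => (Ioi p.1 ×ˢ Ioc 0 p.2).indicator W x) ?_
  filter_upwards [e1, e2] with q h1 h2
  simp only [indicator, mem_prod, mem_Ioi, mem_Ioc, h1, h2]

theorem continuous_setIntegral_Ioi {f : ℝ → ℝ} (hf : Integrable f) :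
    Continuous fun u => ∫ s in Ioi u, f s := by
  have h : (fun u => ∫ s in Ioi u, f s) =
      fun u => (∫ s in Ioi 0, f s) - ∫ s in (0 : ℝ)..u, f s := by
    ext u
    have h1 := intervalIntegral.integral_Iic_add_Ioi (b := u) hf.integrableOn hf.integrableOn
    have h2 := intervalIntegral.integral_Iic_add_Ioi (b := 0) hf.integrableOn hf.integrableOn
    have h3 := intervalIntegral.integral_Iic_sub_Iic (a := 0) (b := u)
      hf.integrableOn hf.integrableOn
    linarith
  rw [h]
  exact continuous_const.sub
    (intervalIntegral.continuous_primitive (fun _ _ => hf.intervalIntegrable) 0)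

theorem abs_setIntegral_le {X : Type*} [MeasurableSpace X] {μ : Measure X} {f : X → ℝ}
    (hf : Integrable f μ) (s : Set X) : |∫ x in s, f x ∂μ| ≤ ∫ x, |f x| ∂μ :=
  abs_integral_le_integral_abs.trans
    (setIntegral_le_integral hf.abs (Eventually.of_forall fun _ => abs_nonneg _))

/-- A weight whose decay turns the Volterra operator into a contraction. -/
noncomputable def volterraWeight (c a u : ℝ) : ℝ := Real.exp (c * min u a)

theorem volterraWeight_pos (c a u : ℝ) : 0 < volterraWeight c a u := Real.exp_pos _

theorem continuous_volterraWeight (c a : ℝ) : Continuous (volterraWeight c a) := by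
  unfold volterraWeight; fun_prop

theorem volterraWeight_le {c : ℝ} (hc : 0 ≤ c) (a u : ℝ) :
    volterraWeight c a u ≤ Real.exp (c * a) :=
  Real.exp_le_exp.2 (mul_le_mul_of_nonneg_left (min_le_right _ _) hc)

theorem volterraWeight_mul_inv {c a u α : ℝ} (h : u < α) (hα : α ≤ a) :
    volterraWeight c a u * (volterraWeight c a α)⁻¹ = Real.exp (-c * α) * Real.exp (c * u) := by
  rw [volterraWeight, volterraWeight, min_eq_left hα, min_eq_left (h.le.trans hα),
    ← Real.exp_neg, mul_comm, neg_mul]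

/-- The right-hand side of the weighted Volterra equation is a bounded continuous function. -/
theorem exists_boundedContinuous_volterra {c : ℝ} (hc : 0 ≤ c) (a : ℝ) {f : ℝ → ℝ}
    (hf : Continuous f) {B : ℝ} (hB : ∀ u, |f u| ≤ B) {W : ℝ × ℝ → ℝ} (hW : Integrable W) :
    ∃ G : ℝ × ℝ →ᵇ ℝ, ∀ p, G p =
      volterraWeight c a p.1 * (f p.1 + ∫ x in Ioi p.1 ×ˢ Ioc 0 p.2, W x) := by
  refine ⟨BoundedContinuousFunction.ofNormedAddCommGroup _
    (((continuous_volterraWeight c a).comp continuous_fst).mul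
      ((hf.comp continuous_fst).add (continuous_setIntegral_Ioi_prod_Ioc hW)))
    (Real.exp (c * a) * (B + ∫ x, |W x|)) fun p => ?_, fun p => rfl⟩
  rw [Real.norm_eq_abs, Pi.mul_apply, abs_mul, Function.comp_apply, abs_of_pos (volterraWeight_pos _ _ _)]
  exact mul_le_mul (volterraWeight_le hc a p.1)
    ((abs_add_le _ _).trans (add_le_add (hB _) (abs_setIntegral_le hW _)))
    (abs_nonneg _) (Real.exp_pos _).le

theorem volterraWeight_mul_abs_setIntegral_le {k : ℝ × ℝ → ℝ} (hk : Integrable k) {a M c : ℝ}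
    (hc : 0 < c) (hk0 : ∀ p, a < p.1 → k p = 0) (hM : ∀ α, ∫ β, |k (α, β)| ≤ M)
    {H : ℝ × ℝ → ℝ} {d : ℝ} (hd : ∀ p, |H p| ≤ d) (p : ℝ × ℝ) :
    volterraWeight c a p.1 *
      |∫ x in Ioi p.1 ×ˢ Ioc 0 p.2, k x * ((volterraWeight c a x.1)⁻¹ * H x)| ≤ M / c * d := by
  have hd0 : 0 ≤ d := (abs_nonneg _).trans (hd 0)
  set e : ℝ → ℝ := (Ioi p.1).indicator fun α => Real.exp (-c * α) * Real.exp (c * p.1) with he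
  have he0 : ∀ α, 0 ≤ e α := fun α => indicator_nonneg (fun _ _ => by positivity) _
  have he1 : ∀ α, e α ≤ 1 := fun α => by
    refine indicator_le' (fun α hα => ?_) (fun _ _ => zero_le_one) α
    rw [← Real.exp_add, Real.exp_le_one_iff]
    nlinarith [mem_Ioi.1 hα]
  have hem : Measurable e := Measurable.indicator (by fun_prop) measurableSet_Ioi
  have heint : Integrable e := by
    rw [he, integrable_indicator_iff measurableSet_Ioi]
    exact (integrableOn_exp_mul_Ioi (neg_lt_zero.2 hc) p.1).mul_const _
  have heI : ∫ α, e α = 1 / c := by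
    rw [he, integral_indicator measurableSet_Ioi, integral_mul_const,
      integral_exp_mul_Ioi (neg_lt_zero.2 hc), neg_div_neg_eq, div_mul_eq_mul_div, ← Real.exp_add]
    simp
  have hg : Integrable fun x : ℝ × ℝ => e x.1 * |k x| :=
    hk.abs.bdd_mul (c := 1) (hem.comp measurable_fst).aestronglyMeasurable
      (Eventually.of_forall fun x => by
        rw [Real.norm_eq_abs, abs_of_nonneg (he0 _)]; exact he1 _)
  have hgI : ∫ x : ℝ × ℝ, e x.1 * |k x| ≤ M / c := by
    rw [Measure.volume_eq_prod, integral_prod _ hg]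
    simp_rw [integral_const_mul]
    calc ∫ α, e α * ∫ β, |k (α, β)| ≤ ∫ α, e α * M :=
          integral_mono_of_nonneg
            (Eventually.of_forall fun α =>
              mul_nonneg (he0 α) (integral_nonneg fun _ => abs_nonneg _))
            (heint.mul_const M)
            (Eventually.of_forall fun α => mul_le_mul_of_nonneg_left (hM α) (he0 α))
      _ = M / c := by rw [integral_mul_const, heI]; ring
  have hpos := volterraWeight_pos c a
  rw [← abs_of_pos (hpos p.1), ← abs_mul, ← integral_const_mul]
  calc |∫ x in Ioi p.1 ×ˢ Ioc 0 p.2,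
          volterraWeight c a p.1 * (k x * ((volterraWeight c a x.1)⁻¹ * H x))|
      ≤ ∫ x in Ioi p.1 ×ˢ Ioc 0 p.2,
          |volterraWeight c a p.1 * (k x * ((volterraWeight c a x.1)⁻¹ * H x))| :=
        abs_integral_le_integral_abs
    _ ≤ ∫ x in Ioi p.1 ×ˢ Ioc 0 p.2, e x.1 * |k x| * d := by
        refine integral_mono_of_nonneg (Eventually.of_forall fun _ => abs_nonneg _)
          (hg.mul_const d).integrableOn ?_
        refine (ae_restrict_iff' (measurableSet_Ioi.prod measurableSet_Ioc)).2
          (Eventually.of_forall fun x hx => ?_)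
        rcases lt_or_ge a x.1 with hxa | hxa
        · simp [hk0 x hxa]
        · have hex : e x.1 = Real.exp (-c * x.1) * Real.exp (c * p.1) := indicator_of_mem hx.1 _
          rw [← volterraWeight_mul_inv hx.1 hxa] at hex
          simp only [hex, abs_mul, abs_inv, abs_of_pos (hpos _)]
          have := mul_le_mul_of_nonneg_left (hd x)
            (mul_nonneg (mul_nonneg (hpos p.1).le (inv_nonneg.2 (hpos x.1).le)) (abs_nonneg (k x)))
          linarith
    _ ≤ ∫ x, e x.1 * |k x| * d :=
        setIntegral_le_integral (hg.mul_const d) (Eventually.of_forall fun x =>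
          mul_nonneg (mul_nonneg (he0 _) (abs_nonneg _)) hd0)
    _ ≤ M / c * d := by
        rw [integral_mul_const]
        exact mul_le_mul_of_nonneg_right hgI hd0

/-- Unique solvability of the weighted Volterra equation among bounded continuous functions. -/
theorem existsUnique_volterra {k : ℝ × ℝ → ℝ} (hk : Integrable k) {a M c : ℝ} (hM0 : 0 ≤ M)
    (hc : M < c) (hk0 : ∀ p, p.1 ∉ Icc 0 a → k p = 0) (hM : ∀ α, ∫ β, |k (α, β)| ≤ M)
    {f : ℝ → ℝ} (hf : Continuous f) {B : ℝ} (hB : ∀ u, |f u| ≤ B) :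
    ∃! G : ℝ × ℝ →ᵇ ℝ, ∀ p, G p = volterraWeight c a p.1 *
      (f p.1 + ∫ x in Ioi p.1 ×ˢ Ioc 0 p.2, k x * ((volterraWeight c a x.1)⁻¹ * G x)) := by
  have hc0 : 0 < c := hM0.trans_lt hc
  have hint : ∀ G : ℝ × ℝ →ᵇ ℝ,
      Integrable fun x => k x * ((volterraWeight c a x.1)⁻¹ * G x) := fun G => by
    refine (hk.mul_const ‖G‖).mono (hk.aestronglyMeasurable.mul
      (Continuous.aestronglyMeasurable ?_)) (Eventually.of_forall fun x => ?_)
    · exact (((continuous_volterraWeight c a).comp continuous_fst).inv₀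
        fun x => (volterraWeight_pos _ _ _).ne').mul G.continuous
    · by_cases hx : x.1 ∈ Icc 0 a
      · rw [norm_mul, norm_mul, norm_mul, norm_norm]
        refine mul_le_mul_of_nonneg_left ?_ (norm_nonneg _)
        refine (mul_le_of_le_one_left (norm_nonneg _) ?_).trans (G.norm_coe_le_norm x)
        rw [norm_inv, Real.norm_eq_abs, abs_of_pos (volterraWeight_pos _ _ _)]
        refine inv_le_one_of_one_le₀ (Real.one_le_exp ?_)
        rw [min_eq_left hx.2]
        exact mul_nonneg hc0.le hx.1
      · simp [hk0 x hx]
  choose Φ hΦ using fun G : ℝ × ℝ →ᵇ ℝ =>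
    exists_boundedContinuous_volterra hc0.le a hf hB (hint G)
  obtain ⟨r, hr⟩ : ∃ r : NNReal, (r : ℝ) = M / c := ⟨⟨_, by positivity⟩, rfl⟩
  have hcontr : ContractingWith r Φ := by
    refine ⟨?_, LipschitzWith.of_dist_le_mul fun G₁ G₂ => ?_⟩
    · rw [← NNReal.coe_lt_coe]
      exact hr.trans_lt ((div_lt_one hc0).2 hc)
    · rw [hr]
      refine (BoundedContinuousFunction.dist_le (by positivity)).2 fun p => ?_
      rw [hΦ, hΦ, Real.dist_eq, ← mul_sub, add_sub_add_left_eq_sub,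
        ← integral_sub (hint G₁).integrableOn (hint G₂).integrableOn, abs_mul,
        abs_of_pos (volterraWeight_pos _ _ _)]
      simp_rw [← mul_sub]
      exact volterraWeight_mul_abs_setIntegral_le hk hc0
        (fun p hp => hk0 p fun h => hp.not_ge h.2) hM
        (H := fun x => G₁ x - G₂ x) (fun x => G₁.dist_coe_le_dist x) p
  refine ⟨hcontr.fixedPoint, fun p => ?_, fun G hG => hcontr.fixedPoint_unique ?_⟩
  · rw [← hΦ, hcontr.fixedPoint_isFixedPt]
  · ext p
    rw [hΦ, ← hG]

/-- The triangle `0 ≤ β ≤ α ≤ a`, on which the Gelfand–Levitan equation lives in the coordinates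
`α = (t + x) / 2`, `β = (t - x) / 2`. -/
def glTriangle (a : ℝ) : Set (ℝ × ℝ) := {p | 0 ≤ p.2 ∧ p.2 ≤ p.1 ∧ p.1 ≤ a}

theorem isClosed_glTriangle (a : ℝ) : IsClosed (glTriangle a) :=
  (isClosed_le continuous_const continuous_snd).inter
    ((isClosed_le continuous_snd continuous_fst).inter (isClosed_le continuous_fst continuous_const))

theorem isCompact_glTriangle (a : ℝ) : IsCompact (glTriangle a) :=
  (isCompact_Icc (a := ((0 : ℝ), (0 : ℝ))) (b := (a, a))).of_isClosed_subset
    (isClosed_glTriangle a) fun _ ⟨h0, h1, h2⟩ => ⟨⟨h0.trans h1, h0⟩, h2, h1.trans h2⟩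

/-- The kernel `q(α - β) - q₀(α + β)` cut off to the triangle `0 ≤ β ≤ α ≤ a`. -/
noncomputable def glKernel (q q₀ : ℝ → ℝ) (a : ℝ) : ℝ × ℝ → ℝ :=
  (glTriangle a).indicator fun p => q (p.1 - p.2) - q₀ (p.1 + p.2)

theorem glKernel_of_notMem {q q₀ : ℝ → ℝ} {a : ℝ} {p : ℝ × ℝ} (hp : p.1 ∉ Icc 0 a) :
    glKernel q q₀ a p = 0 :=
  indicator_of_notMem (fun h => hp ⟨h.1.trans h.2.1, h.2.2⟩) _

theorem integrable_glKernel {q₀ Q : ℝ → ℝ} (hq₀ : Continuous q₀) (hQ : Integrable Q) (a : ℝ) :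
    Integrable (glKernel (fun y => q₀ y + Q y) q₀ a) := by
  have hT := (isClosed_glTriangle a).measurableSet
  have h1 : IntegrableOn (fun p : ℝ × ℝ => q₀ (p.1 - p.2) - q₀ (p.1 + p.2)) (glTriangle a) :=
    ContinuousOn.integrableOn_compact (isCompact_glTriangle a) (by fun_prop)
  have hind : Integrable ((Icc 0 a).indicator fun _ : ℝ => (1 : ℝ)) :=
    (integrable_indicator_iff measurableSet_Icc).2 (integrableOn_const (by simp))
  have h2 : IntegrableOn (fun p : ℝ × ℝ => Q (p.1 - p.2)) (glTriangle a) := by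
    refine (hind.convolution_integrand (ContinuousLinearMap.mul ℝ ℝ) hQ).integrableOn.congr_fun
      (fun p hp => ?_) hT
    have : p.2 ∈ Icc 0 a := ⟨hp.1, hp.2.1.trans hp.2.2⟩
    simp [this]
  refine (integrable_indicator_iff hT).2 ((h1.add h2).congr_fun (fun p _ => ?_) hT)
  simp only [Pi.add_apply]
  ring

theorem integral_abs_glKernel_le {q q₀ : ℝ → ℝ} {a M : ℝ} (hM0 : 0 ≤ M)
    (hM : ∀ α ∈ Icc 0 a, ∫ β in (0 : ℝ)..α, |q (α - β) - q₀ (α + β)| ≤ M) (α : ℝ) :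
    ∫ β, |glKernel q q₀ a (α, β)| ≤ M := by
  by_cases hα : α ∈ Icc 0 a
  · have h : (fun β => |glKernel q q₀ a (α, β)|) =
        (Icc 0 α).indicator fun β => |q (α - β) - q₀ (α + β)| := by
      ext β
      by_cases hβ : β ∈ Icc 0 α
      · have hmem : (α, β) ∈ glTriangle a := ⟨hβ.1, hβ.2, hα.2⟩
        rw [indicator_of_mem hβ, glKernel, indicator_of_mem hmem]
      · rw [indicator_of_notMem hβ, glKernel,
          indicator_of_notMem fun h => hβ ⟨h.1, h.2.1⟩, abs_zero]
    rw [h, integral_indicator measurableSet_Icc, integral_Icc_eq_integral_Ioc,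
      ← intervalIntegral.integral_of_le hα.1]
    exact hM α hα
  · have h : ∀ β, glKernel q q₀ a (α, β) = 0 := fun β => glKernel_of_notMem hα
    simpa [h] using hM0

theorem GLop_eq_setIntegral {q q₀ : ℝ → ℝ} {a : ℝ} {K : ℝ × ℝ → ℝ}
    (hK : ∀ w : ℝ × ℝ, 2 * a ≤ w.1 + w.2 → K w = 0)
    (hint : Integrable fun p : ℝ × ℝ => glKernel q q₀ a p * K (p.1 - p.2, p.1 + p.2))
    {x t : ℝ} (hx : 0 ≤ x) (hxt : x ≤ t) :
    GLop q q₀ K (x, t) = ∫ p in Ioi ((t + x) / 2) ×ˢ Ioc 0 ((t - x) / 2),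
      glKernel q q₀ a p * K (p.1 - p.2, p.1 + p.2) := by
  rw [Measure.volume_eq_prod, setIntegral_prod _ hint.integrableOn, GLop]
  refine setIntegral_congr_fun measurableSet_Ioi fun α hα => ?_
  simp only
  rw [intervalIntegral.integral_of_le (by linarith)]
  refine setIntegral_congr_fun measurableSet_Ioc fun β hβ => ?_
  have hα' : (t + x) / 2 < α := hα
  rcases le_or_gt α a with h | h
  · have : ((α, β) : ℝ × ℝ) ∈ glTriangle a := ⟨hβ.1.le, by linarith [hβ.2], h⟩
    simp only [glKernel, indicator_of_mem this]
  · simp only [hK (α - β, α + β) (by simp only; linarith), mul_zero]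

theorem integrable_mul_of_continuousOn_of_eq_zero {X : Type*} [TopologicalSpace X] [T2Space X]
    [MeasurableSpace X] [BorelSpace X] {μ : Measure X} {k F : X → ℝ}
    (hk : Integrable k μ) {s : Set X} (hs : IsCompact s) (hk0 : ∀ x ∉ s, k x = 0)
    (hF : ContinuousOn F s) : Integrable (fun x => k x * F x) μ := by
  have h := hk.integrableOn.mul_continuousOn hF hs
  refine ((integrable_indicator_iff hs.measurableSet).2 h).congr (Eventually.of_forall fun x => ?_)
  by_cases hx : x ∈ s
  · rw [indicator_of_mem hx]
  · simp only [indicator_of_notMem hx, hk0 x hx, zero_mul]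

/-- Existence and uniqueness of the Gelfand–Levitan transformation kernel: with
`q₀(x) = −λ e^{−2x}`, `q = q₀ + Q` for an integrable `Q` supported in `[0, a]` with the
finiteness condition on `M`, there is a unique continuous kernel `K` on
`Ω = {(x,t) : 0 ≤ x ≤ t}` (normalized to vanish off `Ω`) vanishing when `x + t ≥ 2a` and
satisfying the fixed-point equation
`K(x,t) = ½∫_{(t+x)/2}^∞ Q + ∫_{(t+x)/2}^∞ ∫₀^{(t−x)/2} (q(α−β) − q₀(α+β)) K(α−β,α+β) dβ dα`. -/
theorem GL_kernel_exists_unique (lam a : ℝ) (hlam : 0 < lam) (ha : 0 < a)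
    (Q : ℝ → ℝ) (hQ : Integrable Q) (hQsupp : Function.support Q ⊆ Set.Icc 0 a)
    (M : ℝ)
    (hM : ∀ x t : ℝ, 0 ≤ x → x ≤ t → ∀ α ∈ Set.Icc ((t - x) / 2) a,
      (∫ β in (0:ℝ)..((t - x) / 2),
        |(-lam * Real.exp (-2 * (α - β)) + Q (α - β)) - (-lam * Real.exp (-2 * (α + β)))|)
        ≤ M) :
    ∃! K : ℝ × ℝ → ℝ,
      ContinuousOn K {w : ℝ × ℝ | 0 ≤ w.1 ∧ w.1 ≤ w.2} ∧
      (∀ w : ℝ × ℝ, 2 * a ≤ w.1 + w.2 → K w = 0) ∧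
      (∀ w : ℝ × ℝ, ¬(0 ≤ w.1 ∧ w.1 ≤ w.2) → K w = 0) ∧
      (∀ x t : ℝ, 0 ≤ x → x ≤ t →
        K (x, t) = (1 / 2) * (∫ s in Set.Ioi ((t + x) / 2), Q s) +
          GLop (fun y => -lam * Real.exp (-2 * y) + Q y)
            (fun y => -lam * Real.exp (-2 * y)) K (x, t)) := by
  set q₀ : ℝ → ℝ := fun y => -lam * Real.exp (-2 * y)
  set q : ℝ → ℝ := fun y => -lam * Real.exp (-2 * y) + Q y
  set k := glKernel q q₀ a with hk_def
  have hM0 : 0 ≤ M := by simpa using hM 0 0 le_rfl le_rfl 0 ⟨by simp, ha.le⟩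
  have hk : Integrable k := integrable_glKernel (q₀ := q₀) (by fun_prop) hQ a
  have hkM : ∀ α, ∫ β, |k (α, β)| ≤ M := integral_abs_glKernel_le hM0 fun α hα => by
    have h := hM 0 (2 * α) le_rfl (by linarith [hα.1]) α (by simpa using hα.2)
    rwa [sub_zero, mul_div_cancel_left₀ α two_ne_zero] at h
  set f : ℝ → ℝ := fun u => 1 / 2 * ∫ s in Ioi u, Q s with hf_def
  have hf : Continuous f := continuous_const.mul (continuous_setIntegral_Ioi hQ)
  have hfB : ∀ u, |f u| ≤ 1 / 2 * ∫ s, |Q s| := fun u => by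
    rw [hf_def, abs_mul, abs_of_pos (by norm_num : (0 : ℝ) < 1 / 2)]
    exact mul_le_mul_of_nonneg_left (abs_setIntegral_le hQ _) (by norm_num)
  have hf0 : ∀ u, a ≤ u → f u = 0 := fun u hu => by
    have : ∫ s in Ioi u, Q s = 0 := setIntegral_eq_zero_of_forall_eq_zero fun s hs =>
      Function.notMem_support.1 fun h => (hu.trans_lt hs).not_ge (hQsupp h).2
    simp [hf_def, this]
  obtain ⟨G, hG, hGu⟩ := existsUnique_volterra hk hM0 (lt_add_one M)
    (fun p hp => glKernel_of_notMem hp) hkM hf hfB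
  set w := volterraWeight (M + 1) a
  have hw0 : ∀ u, w u ≠ 0 := fun u => (volterraWeight_pos _ _ u).ne'
  have hwc : Continuous w := continuous_volterraWeight _ _
  have hG0 : ∀ p : ℝ × ℝ, a ≤ p.1 → G p = 0 := fun p hp => by
    rw [hG, hf0 _ hp, setIntegral_eq_zero_of_forall_eq_zero, add_zero, mul_zero]
    intro x hx
    rw [hk_def, glKernel_of_notMem fun h => (hp.trans_lt hx.1).not_ge h.2, zero_mul]
  have hmaps : MapsTo (fun p : ℝ × ℝ => (p.1 - p.2, p.1 + p.2)) (glTriangle a)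
      {w : ℝ × ℝ | 0 ≤ w.1 ∧ w.1 ≤ w.2} := fun p hp =>
    ⟨sub_nonneg.2 hp.2.1, by simp only; linarith [hp.1]⟩
  have hint : ∀ K : ℝ × ℝ → ℝ, ContinuousOn K {w : ℝ × ℝ | 0 ≤ w.1 ∧ w.1 ≤ w.2} →
      Integrable fun p : ℝ × ℝ => k p * K (p.1 - p.2, p.1 + p.2) := fun K hK =>
    integrable_mul_of_continuousOn_of_eq_zero hk (isCompact_glTriangle a)
      (fun p hp => indicator_of_notMem hp _) (hK.comp (by fun_prop) hmaps)
  classical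
  refine ⟨fun v => if 0 ≤ v.1 ∧ v.1 ≤ v.2 then
    (w ((v.2 + v.1) / 2))⁻¹ * G ((v.2 + v.1) / 2, (v.2 - v.1) / 2) else 0, ?_, ?_⟩
  · set K : ℝ × ℝ → ℝ := fun v => if 0 ≤ v.1 ∧ v.1 ≤ v.2 then
      (w ((v.2 + v.1) / 2))⁻¹ * G ((v.2 + v.1) / 2, (v.2 - v.1) / 2) else 0 with hK_def
    have hKc : ContinuousOn K {w : ℝ × ℝ | 0 ≤ w.1 ∧ w.1 ≤ w.2} := by
      refine ContinuousOn.congr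
        (f := fun v : ℝ × ℝ => (w ((v.2 + v.1) / 2))⁻¹ * G ((v.2 + v.1) / 2, (v.2 - v.1) / 2))
        (Continuous.continuousOn ?_) fun v (hv : 0 ≤ v.1 ∧ v.1 ≤ v.2) => if_pos hv
      exact ((hwc.comp (by fun_prop)).inv₀ fun _ => hw0 _).mul (G.continuous.comp (by fun_prop))
    have hKa : ∀ w : ℝ × ℝ, 2 * a ≤ w.1 + w.2 → K w = 0 := fun v hv => by
      simp only [hK_def]
      rw [hG0 _ (by simp only; linarith), mul_zero, ite_self]
    refine ⟨hKc, hKa, fun v hv => if_neg hv, fun x t hx hxt => ?_⟩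
    rw [GLop_eq_setIntegral hKa (hint K hKc) hx hxt]
    have hKG : (fun p : ℝ × ℝ => k p * K (p.1 - p.2, p.1 + p.2)) =
        fun p => k p * ((w p.1)⁻¹ * G p) := by
      ext p
      by_cases hp : p ∈ glTriangle a
      · have e1 : (p.1 + p.2 + (p.1 - p.2)) / 2 = p.1 := by ring
        have e2 : (p.1 + p.2 - (p.1 - p.2)) / 2 = p.2 := by ring
        have e3 : K (p.1 - p.2, p.1 + p.2) = (w p.1)⁻¹ * G p := by
          refine (if_pos (hmaps hp)).trans ?_
          simp only [e1, e2]
        rw [e3]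
      · rw [hk_def, glKernel, indicator_of_notMem hp, zero_mul, zero_mul]
    rw [hKG]
    refine (if_pos ⟨hx, hxt⟩).trans ?_
    rw [hG, inv_mul_cancel_left₀ (hw0 _)]
  · rintro K ⟨hKc, hKa, hKoff, hKeq⟩
    obtain ⟨H, hH⟩ := exists_boundedContinuous_volterra (c := M + 1) (by positivity) a hf hfB
      (hint K hKc)
    have hKH : ∀ x t : ℝ, 0 ≤ x → x ≤ t →
        K (x, t) = (w ((t + x) / 2))⁻¹ * H ((t + x) / 2, (t - x) / 2) := fun x t hx hxt => by
      rw [hKeq x t hx hxt, GLop_eq_setIntegral hKa (hint K hKc) hx hxt, hH,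
        inv_mul_cancel_left₀ (hw0 _)]
    have hHG : H = G := hGu H fun p => by
      rw [hH]
      congr 3
      ext p
      by_cases hp : p ∈ glTriangle a
      · have e1 : (p.1 + p.2 + (p.1 - p.2)) / 2 = p.1 := by ring
        have e2 : (p.1 + p.2 - (p.1 - p.2)) / 2 = p.2 := by ring
        rw [hKH _ _ (hmaps hp).1 (hmaps hp).2, e1, e2]
      · rw [hk_def, glKernel, indicator_of_notMem hp, zero_mul, zero_mul]
    ext v
    by_cases hv : 0 ≤ v.1 ∧ v.1 ≤ v.2
    · rw [if_pos hv, ← hHG]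
      exact hKH v.1 v.2 hv.1 hv.2
    · rw [if_neg hv, hKoff v hv]
end
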